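/- (Approximate noise tolerance.) Let L satisfy the symmetry condition with constant K > 0 and assume x ↦ L(f(x), y(x)) is measurable for every f ∈ F. Let η : X → [0,1] be a measurable noise-rate function and η_max < 1/2 a constant with η(x) ≤ η_max for p-almost every x. Suppose f* ∈ F is a global minimizer of R_L over F with R_L(f*) = ε, and f*_η ∈ F is a global minimizer of the noisy L-risk R_L^η over F. Then R_L(f*_η) ≤ ε / (1 − 2·η_max). -/

import Mathlib

open MeasureTheory

/-- A loss with the symmetry condition flips to `K - L` under a label flip. -/
lemma symmetric_loss_neg_label {L : ℝ → ℝ → ℝ} {K : ℝ} (hsym : ∀ t, L t 1 + L t (-1) = K)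
    (t : ℝ) {u : ℝ} (hu : u = 1 ∨ u = -1) : L t (-u) = K - L t u := by
  have h := hsym t
  rcases hu with rfl | rfl
  · linarith
  · rw [neg_neg]
    linarith

/-- Approximate noise tolerance: if `L` satisfies the symmetry condition with constant `K > 0`,
the noise rate satisfies `η(x) ≤ η_max < 1/2` almost everywhere, `f*` is a global minimizer of
the noise-free `L`-risk over `F` with risk value `ε`, and `f*_η` is a global minimizer of the
noisy `L`-risk over `F`, then `R_L(f*_η) ≤ ε / (1 - 2 η_max)`. -/
theorem approximate_noise_tolerance
    {X : Type*} [MeasurableSpace X] (p : Measure X) [IsProbabilityMeasure p]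
    (y : X → ℝ) (hy : Measurable y) (hy1 : ∀ x, y x = 1 ∨ y x = -1)
    (L : ℝ → ℝ → ℝ) (hL : ∀ t u, 0 ≤ L t u)
    (K : ℝ) (hK : 0 < K) (hsym : ∀ t, L t 1 + L t (-1) = K)
    (F : Set (X → ℝ)) (hF : ∀ f ∈ F, Measurable f)
    (hmeas : ∀ f ∈ F, Measurable (fun x => L (f x) (y x)))
    (η : X → ℝ) (hη : Measurable η) (hη01 : ∀ x, 0 ≤ η x ∧ η x ≤ 1)
    (ηmax : ℝ) (hηmax : ηmax < 1 / 2) (hηle : ∀ᵐ x ∂p, η x ≤ ηmax)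
    (ε : ℝ)
    (fstar : X → ℝ) (hfstar : fstar ∈ F)
    (hmin : ∀ f ∈ F, ∫ x, L (fstar x) (y x) ∂p ≤ ∫ x, L (f x) (y x) ∂p)
    (hε : ∫ x, L (fstar x) (y x) ∂p = ε)
    (fη : X → ℝ) (hfη : fη ∈ F)
    (hminη : ∀ f ∈ F,
      ∫ x, ((1 - η x) * L (fη x) (y x) + η x * L (fη x) (-(y x))) ∂p
        ≤ ∫ x, ((1 - η x) * L (f x) (y x) + η x * L (f x) (-(y x))) ∂p) :
    ∫ x, L (fη x) (y x) ∂p ≤ ε / (1 - 2 * ηmax) := by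
  have hflip : ∀ (f : X → ℝ) x, L (f x) (-(y x)) = K - L (f x) (y x) := fun f x =>
    symmetric_loss_neg_label hsym (f x) (hy1 x)
  have hle : ∀ (f : X → ℝ) x, L (f x) (y x) ≤ K := fun f x => by
    have h := hL (f x) (-(y x))
    rw [hflip] at h
    linarith
  have hint : ∀ f ∈ F, Integrable (fun x => L (f x) (y x)) p := fun f hf =>
    Integrable.of_bound (hmeas f hf).aestronglyMeasurable K
      (.of_forall fun x => by
        rw [Real.norm_of_nonneg (hL _ _)]
        exact hle f x)
  have hηint : Integrable η p :=
    Integrable.of_bound hη.aestronglyMeasurable 1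
      (.of_forall fun x => by
        rw [Real.norm_of_nonneg (hη01 x).1]
        exact (hη01 x).2)
  have hwint : ∀ f ∈ F, Integrable (fun x => (1 - 2 * η x) * L (f x) (y x)) p := fun f hf =>
    (hint f hf).bdd_mul (c := 1) (by fun_prop)
      (.of_forall fun x => by
        rw [Real.norm_eq_abs, abs_le]
        constructor <;> linarith [(hη01 x).1, (hη01 x).2])
  have hnoisy : ∀ f ∈ F,
      ∫ x, ((1 - η x) * L (f x) (y x) + η x * L (f x) (-(y x))) ∂p
        = ∫ x, (1 - 2 * η x) * L (f x) (y x) ∂p + ∫ x, η x * K ∂p := fun f hf => by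
    rw [← integral_add (hwint f hf) (hηint.mul_const K)]
    refine integral_congr_ae (.of_forall fun x => ?_)
    simp only [hflip]
    ring
  have hweighted := hminη fstar hfstar
  rw [hnoisy _ hfη, hnoisy _ hfstar] at hweighted
  have hlower : (1 - 2 * ηmax) * ∫ x, L (fη x) (y x) ∂p
      ≤ ∫ x, (1 - 2 * η x) * L (fη x) (y x) ∂p := by
    rw [← integral_const_mul]
    refine integral_mono_ae ((hint _ hfη).const_mul _) (hwint _ hfη) ?_
    filter_upwards [hηle] with x hx
    exact mul_le_mul_of_nonneg_right (by linarith) (hL _ _)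
  have hupper : ∫ x, (1 - 2 * η x) * L (fstar x) (y x) ∂p ≤ ∫ x, L (fstar x) (y x) ∂p :=
    integral_mono (hwint _ hfstar) (hint _ hfstar) fun x =>
      mul_le_of_le_one_left (hL _ _) (by linarith [(hη01 x).1])
  rw [le_div_iff₀ (by linarith)]
  linarith
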